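/- Let A be an associative unital algebra over a commutative ring k, Ω a semigroup, and λ ∈ k. The pair (A, (R_ω + λ·id, R_ω)_{ω∈Ω}) is a Rota-Baxter system family algebra if and only if (A, (R_ω)_{ω∈Ω}) is a Rota-Baxter family algebra of weight λ. -/

import Mathlib

/-- The pair `(A, (R_ω + λ·id, R_ω)_{ω∈Ω})` is a Rota-Baxter system family algebra
iff `(A, (R_ω)_{ω∈Ω})` is a Rota-Baxter family algebra of weight `λ`. -/
theorem stmt_1 {k A Ω : Type*} [CommRing k] [Ring A] [Algebra k A] [Semigroup Ω]
    (l : k) (R : Ω → (A →ₗ[k] A)) :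
    (∀ (α β : Ω) (a b : A),
        (R α a + l • a) * (R β b + l • b)
          = (R (α * β) ((R α a + l • a) * b + a * R β b)
             + l • ((R α a + l • a) * b + a * R β b)) ∧
        R α a * R β b = R (α * β) ((R α a + l • a) * b + a * R β b))
    ↔ (∀ (α β : Ω) (a b : A),
        R α a * R β b = R (α * β) (R α a * b + a * R β b + l • (a * b))) := by
  have arg_eq (α β : Ω) (a b : A) :
      (R α a + l • a) * b + a * R β b = R α a * b + a * R β b + l • (a * b) := by
    rw [add_mul, smul_mul_assoc]
    abel
  simp only [arg_eq]
  refine ⟨fun h α β a b => (h α β a b).2, fun h α β a b => ⟨?_, h α β a b⟩⟩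
  rw [← h α β a b]
  simp only [add_mul, mul_add, smul_mul_assoc, mul_smul_comm, smul_add]
  abel
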